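/- arXiv:2512.14979 — 2 statements merged into one kernel-verified Lean document; each statement's English description precedes it below -/
import Mathlib

section
/- Under the standing stochastic setup, let K ≥ 1 and l₀ ∈ ℕ∖{0}, suppose N_k = k + 1 for all k ∈ {0, …, K−1}, suppose the sampled Armijo condition holds almost surely at every iteration k ∈ {0, …, K−1}, and suppose that almost surely the number of indices k ∈ {0, …, K−1} with t_k ≠ t_{k−1} (t_{−1} ≜ s) is at most ⌈log₂((l₀ + K)/l₀)⌉ ⌈[log_{1/β}(sL/(2(1−α)))]_+ + 2⌉. Then (1/K) Σ_{k=0}^{K−1} E[‖G_s(x_k)‖²] ≤ 2(φ(x_0) − φ_inf)/(α c K) + (1/L + 6 L s² + 2 α c) σ² (ln(K) + 1)/(α c K) + 6 L (s − c)² (L_r + 3 B_g)² ⌈[log_{1/β}(sL/(2(1−α)))]_+ + 2⌉ ⌈log₂((l₀ + K)/l₀)⌉/(α c K), where [u]_+ ≜ max{u, 0}. -/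
open MeasureTheory Filter
open scoped RealInnerProductSpace

section Prox

variable {E : Type*} [NormedAddCommGroup E] [InnerProductSpace ℝ E]

/-- `p` minimizes `y ↦ r y + ‖y - z‖ ^ 2 / (2 * t)` over `S`. -/
def IsProxPoint (S : Set E) (r : E → ℝ) (t : ℝ) (z p : E) : Prop :=
  p ∈ S ∧ ∀ y ∈ S, r p + ‖p - z‖ ^ 2 / (2 * t) ≤ r y + ‖y - z‖ ^ 2 / (2 * t)

variable {S : Set E} {r : E → ℝ}

theorem IsProxPoint.subgradient (hr : ConvexOn ℝ S r) {t : ℝ} (ht : 0 < t) {z p : E}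
    (hp : IsProxPoint S r t z p) {y : E} (hy : y ∈ S) :
    r p + ⟪t⁻¹ • (z - p), y - p⟫ ≤ r y := by
  have key : ∀ l : ℝ, 0 < l → l ≤ 1 →
      r p + ⟪t⁻¹ • (z - p), y - p⟫ ≤ r y + l * (‖y - p‖ ^ 2 / (2 * t)) := by
    intro l hl hl1
    have hq : (1 - l) • p + l • y ∈ S := hr.1 hp.1 hy (by linarith) hl.le (by ring)
    have h1 := hp.2 _ hq
    have h2 : r ((1 - l) • p + l • y) ≤ (1 - l) * r p + l * r y := by
      simpa using hr.2 hp.1 hy (by linarith : 0 ≤ 1 - l) hl.le (by ring)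
    have h3 : (1 - l) • p + l • y - z = l • (y - p) - (z - p) := by module
    have h4 : ‖p - z‖ = ‖z - p‖ := norm_sub_rev _ _
    rw [h3, h4, norm_sub_sq_real (l • (y - p)), norm_smul, real_inner_smul_left, Real.norm_eq_abs,
      mul_pow, sq_abs] at h1
    rw [real_inner_smul_left, real_inner_comm]
    have h5 : (l ^ 2 * ‖y - p‖ ^ 2 - 2 * (l * ⟪y - p, z - p⟫) + ‖z - p‖ ^ 2) / (2 * t)
        = l * (l * (‖y - p‖ ^ 2 / (2 * t))) - l * (t⁻¹ * ⟪y - p, z - p⟫)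
          + ‖z - p‖ ^ 2 / (2 * t) := by
      field_simp
    rw [h5] at h1
    refine le_of_mul_le_mul_left ?_ hl
    linarith
  refine le_of_forall_pos_le_add fun ε hε => ?_
  have hD : 0 ≤ ‖y - p‖ ^ 2 / (2 * t) := by positivity
  have hpos : 0 < min 1 (ε / (‖y - p‖ ^ 2 / (2 * t) + 1)) := by positivity
  refine (key _ hpos (min_le_left _ _)).trans ?_
  gcongr
  calc _ ≤ ε / (‖y - p‖ ^ 2 / (2 * t) + 1) * (‖y - p‖ ^ 2 / (2 * t) + 1) := by
        gcongr
        · exact min_le_right _ _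
        · linarith
    _ = ε := by field_simp

theorem IsProxPoint.monotone (hr : ConvexOn ℝ S r) {t t' : ℝ} (ht : 0 < t) (ht' : 0 < t')
    {z z' p p' : E} (hp : IsProxPoint S r t z p) (hp' : IsProxPoint S r t' z' p') :
    0 ≤ ⟪t⁻¹ • (z - p) - t'⁻¹ • (z' - p'), p - p'⟫ := by
  have h1 := hp.subgradient hr ht hp'.1
  have h2 := hp'.subgradient hr ht' hp.1
  rw [inner_sub_left]
  rw [← neg_sub p p', inner_neg_right] at h1
  linarith

theorem IsProxPoint.norm_sub_le (hr : ConvexOn ℝ S r) {t : ℝ} (ht : 0 < t)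
    {z z' p p' : E} (hp : IsProxPoint S r t z p) (hp' : IsProxPoint S r t z' p') :
    ‖p - p'‖ ≤ ‖z - z'‖ := by
  have h := hp.monotone hr ht ht hp'
  have h1 : t⁻¹ • (z - p) - t⁻¹ • (z' - p') = t⁻¹ • ((z - z') - (p - p')) := by module
  rw [h1, real_inner_smul_left, inner_sub_left, real_inner_self_eq_norm_sq] at h
  have h2 := nonneg_of_mul_nonneg_right h (inv_pos.2 ht)
  have h3 := real_inner_le_norm (z - z') (p - p')
  by_contra! h4
  nlinarith [norm_nonneg (z - z')]

/-- The prox-gradient mapping is bounded by the Lipschitz constant of `r` plus the gradient norm. -/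
theorem IsProxPoint.norm_gradientMap_le (hr : ConvexOn ℝ S r) {Lr : ℝ} (hLr : 0 ≤ Lr)
    (hrlip : ∀ z ∈ S, ∀ w ∈ S, |r z - r w| ≤ Lr * ‖z - w‖)
    {t : ℝ} (ht : 0 < t) {x v p : E} (hx : x ∈ S) (hp : IsProxPoint S r t (x - t • v) p) :
    ‖t⁻¹ • (x - p)‖ ≤ Lr + ‖v‖ := by
  have h := hp.subgradient hr ht hx
  have h1 : t⁻¹ • (x - t • v - p) = t⁻¹ • (x - p) - v := by
    rw [sub_right_comm, smul_sub, smul_smul, inv_mul_cancel₀ ht.ne', one_smul]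
  rw [h1, inner_sub_left, real_inner_smul_left, real_inner_self_eq_norm_sq] at h
  have h2 := (abs_le.1 (hrlip x hx p hp.1)).2
  have h3 := real_inner_le_norm v (x - p)
  rw [norm_smul, Real.norm_eq_abs, abs_of_pos (inv_pos.2 ht)]
  have h4 := norm_nonneg v
  by_contra! h5
  have h6 : 0 < ‖x - p‖ := by
    by_contra! h7
    have : ‖x - p‖ = 0 := le_antisymm h7 (norm_nonneg _)
    rw [this] at h5
    linarith
  nlinarith [mul_lt_mul_of_pos_right h5 h6]

/-- The prox-gradient step is Lipschitz in the step size. -/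
theorem IsProxPoint.norm_sub_le_of_step (hr : ConvexOn ℝ S r) {Lr : ℝ} (hLr : 0 ≤ Lr)
    (hrlip : ∀ z ∈ S, ∀ w ∈ S, |r z - r w| ≤ Lr * ‖z - w‖)
    {t t' : ℝ} (ht : 0 < t) (ht' : 0 < t') {x v p p' : E} (hx : x ∈ S)
    (hp : IsProxPoint S r t (x - t • v) p) (hp' : IsProxPoint S r t' (x - t' • v) p') :
    ‖p - p'‖ ≤ |t - t'| * (Lr + ‖v‖) := by
  have hm := hp.monotone hr ht ht' hp'
  have hG := hp'.norm_gradientMap_le hr hLr hrlip ht' hx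
  have h1 : t⁻¹ • (x - t • v - p) - t'⁻¹ • (x - t' • v - p')
      = t⁻¹ • ((t' - t) • t'⁻¹ • (x - p') - (p - p')) := by
    match_scalars <;> field_simp <;> ring
  rw [h1, real_inner_smul_left, inner_sub_left, real_inner_self_eq_norm_sq] at hm
  have h2 := nonneg_of_mul_nonneg_right hm (inv_pos.2 ht)
  have h3 := real_inner_le_norm ((t' - t) • t'⁻¹ • (x - p')) (p - p')
  rw [norm_smul, Real.norm_eq_abs, abs_sub_comm] at h3
  by_contra! h4
  have h5 : |t - t'| * ‖t'⁻¹ • (x - p')‖ ≤ |t - t'| * (Lr + ‖v‖) := by gcongr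
  have h6 : 0 ≤ |t - t'| * (Lr + ‖v‖) := by positivity
  nlinarith [norm_nonneg (p - p')]

/-- The norm of the prox-gradient mapping is nonincreasing in the step size. -/
theorem IsProxPoint.norm_gradientMap_antitone (hr : ConvexOn ℝ S r)
    {t s : ℝ} (ht : 0 < t) (hts : t ≤ s) {x v p q : E}
    (hp : IsProxPoint S r t (x - t • v) p) (hq : IsProxPoint S r s (x - s • v) q) :
    ‖s⁻¹ • (x - q)‖ ≤ ‖t⁻¹ • (x - p)‖ := by
  have hs := ht.trans_le hts
  have hm := hp.monotone hr ht hs hq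
  set a := t⁻¹ • (x - p) with ha
  set b := s⁻¹ • (x - q) with hb
  have h1 : t⁻¹ • (x - t • v - p) - s⁻¹ • (x - s • v - q) = a - b := by
    rw [ha, hb]
    match_scalars <;> field_simp
    ring
  have h2 : p - q = s • b - t • a := by
    rw [ha, hb, smul_smul, smul_smul, mul_inv_cancel₀ ht.ne', mul_inv_cancel₀ hs.ne']
    module
  rw [h1, h2] at hm
  simp only [inner_sub_left, inner_sub_right, real_inner_smul_right,
    real_inner_self_eq_norm_sq, real_inner_comm a b] at hm
  have h3 := real_inner_le_norm a b
  by_contra! h4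
  have h5 : (s + t) * ⟪a, b⟫ ≤ (s + t) * (‖a‖ * ‖b‖) := by gcongr
  have h6 : 0 < (‖b‖ - ‖a‖) * (s * ‖b‖ - t * ‖a‖) := by
    apply mul_pos (by linarith)
    nlinarith [norm_nonneg a]
  nlinarith

/-- Joint continuity of the prox-gradient step in the step size and the base point. -/
theorem continuousOn_proxGradient (hr : ConvexOn ℝ S r) {Lr : ℝ} (hLr : 0 ≤ Lr)
    (hrlip : ∀ z ∈ S, ∀ w ∈ S, |r z - r w| ≤ Lr * ‖z - w‖)
    {g : E → E} {L : ℝ} (hL : 0 ≤ L) (hg : ∀ z ∈ S, ∀ w ∈ S, ‖g z - g w‖ ≤ L * ‖z - w‖)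
    {Bg : ℝ} (hBg : ∀ z ∈ S, ‖g z‖ ≤ Bg) {prox : ℝ → E → E}
    (hprox : ∀ t : ℝ, 0 < t → ∀ z, IsProxPoint S r t z (prox t z)) {c s : ℝ} (hc : 0 < c) :
    ContinuousOn (fun q : ℝ × E => prox q.1 (q.2 - q.1 • g q.2)) (Set.Icc c s ×ˢ S) := by
  refine (LipschitzOnWith.of_dist_le_mul (K := (1 + s * L + (Lr + Bg)).toNNReal) ?_).continuousOn
  rintro ⟨t, x⟩ ⟨ht, hx⟩ ⟨t', x'⟩ ⟨ht', hx'⟩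
  simp only at ht hx ht' hx'
  have ht0 : 0 < t := hc.trans_le ht.1
  have ht0' : 0 < t' := hc.trans_le ht'.1
  have hs0 : 0 < s := ht0.trans_le ht.2
  have hBg0 : 0 ≤ Bg := (norm_nonneg _).trans (hBg x hx)
  rw [Real.coe_toNNReal _ (by positivity), dist_eq_norm]
  have h1 := (hprox t ht0 (x - t • g x)).norm_sub_le hr ht0 (hprox t ht0 (x' - t • g x'))
  have h2 := (hprox t ht0 (x' - t • g x')).norm_sub_le_of_step hr hLr hrlip ht0 ht0' hx'
    (hprox t' ht0' (x' - t' • g x'))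
  have h3 : ‖x - t • g x - (x' - t • g x')‖ ≤ ‖x - x'‖ + s * (L * ‖x - x'‖) := by
    have : x - t • g x - (x' - t • g x') = (x - x') - t • (g x - g x') := by module
    rw [this]
    refine (norm_sub_le _ _).trans ?_
    rw [norm_smul, Real.norm_eq_abs, abs_of_pos ht0]
    gcongr
    · exact ht.2
    · exact hg x hx x' hx'
  have h4 : ‖x - x'‖ ≤ dist (t, x) (t', x') := by
    rw [← dist_eq_norm]
    exact le_max_right _ _
  have h5 : |t - t'| ≤ dist (t, x) (t', x') := by
    rw [← Real.dist_eq]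
    exact le_max_left _ _
  calc _ ≤ _ := norm_sub_le_norm_sub_add_norm_sub _ (prox t (x' - t • g x')) _
    _ ≤ (‖x - x'‖ + s * (L * ‖x - x'‖)) + |t - t'| * (Lr + Bg) := by
        refine add_le_add (h1.trans h3) (h2.trans ?_)
        gcongr
        exact hBg x' hx'
    _ = (1 + s * L) * ‖x - x'‖ + (Lr + Bg) * |t - t'| := by ring
    _ ≤ (1 + s * L) * dist (t, x) (t', x') + (Lr + Bg) * dist (t, x) (t', x') := by gcongr
    _ = _ := by ring

variable [CompleteSpace E]

theorem HasGradientAt.sub' {f h : E → ℝ} {u v x : E} (hf : HasGradientAt f u x)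
    (hh : HasGradientAt h v x) : HasGradientAt (fun y => f y - h y) (u - v) x := by
  rw [hasGradientAt_iff_hasFDerivAt] at *
  rw [map_sub]
  exact hf.sub hh

/-- Descent lemma for a function whose gradient is Lipschitz on a convex set. -/
theorem descent_of_lipschitz_gradient (hS : Convex ℝ S) {h : E → ℝ} {w : E → E}
    (hh : ∀ z ∈ S, HasGradientAt h (w z) z) {M : ℝ}
    (hw : ∀ z ∈ S, ∀ y ∈ S, ‖w z - w y‖ ≤ M * ‖z - y‖) {a b : E} (ha : a ∈ S) (hb : b ∈ S) :
    h b ≤ h a + ⟪w a, b - a⟫ + M / 2 * ‖b - a‖ ^ 2 := by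
  have hmem : ∀ θ ∈ Set.Icc (0 : ℝ) 1, a + θ • (b - a) ∈ S := fun θ hθ =>
    hS.add_smul_sub_mem ha hb hθ
  have hd : ∀ θ ∈ Set.Icc (0 : ℝ) 1, HasDerivAt
      (fun θ : ℝ => h (a + θ • (b - a)) - θ * ⟪w a, b - a⟫ - M / 2 * θ ^ 2 * ‖b - a‖ ^ 2)
      (⟪w (a + θ • (b - a)), b - a⟫ - ⟪w a, b - a⟫ - M * θ * ‖b - a‖ ^ 2) θ := by
    intro θ hθ
    have h1 := (hh _ (hmem θ hθ)).hasFDerivAt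
    have h2 : HasDerivAt (fun θ : ℝ => a + θ • (b - a)) (b - a) θ := by
      simpa using ((hasDerivAt_id θ).smul_const (b - a)).const_add a
    have h3 := h1.comp_hasDerivAt θ h2
    have h4 : HasDerivAt (fun θ : ℝ => θ * ⟪w a, b - a⟫) ⟪w a, b - a⟫ θ := by
      simpa using (hasDerivAt_id θ).mul_const ⟪w a, b - a⟫
    have h5 : HasDerivAt (fun θ : ℝ => M / 2 * θ ^ 2 * ‖b - a‖ ^ 2)
        (M * θ * ‖b - a‖ ^ 2) θ := by
      refine (((hasDerivAt_pow 2 θ).const_mul (M / 2)).mul_const (‖b - a‖ ^ 2)).congr_deriv ?_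
      simp only [Nat.cast_ofNat, Nat.add_one_sub_one, pow_one]
      ring
    exact (h3.sub h4).sub h5
  have hanti : AntitoneOn
      (fun θ : ℝ => h (a + θ • (b - a)) - θ * ⟪w a, b - a⟫ - M / 2 * θ ^ 2 * ‖b - a‖ ^ 2)
      (Set.Icc 0 1) := by
    refine antitoneOn_of_hasDerivWithinAt_nonpos (convex_Icc 0 1)
      (fun θ hθ => (hd θ hθ).continuousAt.continuousWithinAt)
      (fun θ hθ => (hd θ (interior_subset hθ)).hasDerivWithinAt) fun θ hθ => ?_
    have hθ := interior_subset hθ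
    have h1 := real_inner_le_norm (w (a + θ • (b - a)) - w a) (b - a)
    have h2 := hw _ (hmem θ hθ) a ha
    rw [add_sub_cancel_left, norm_smul, Real.norm_eq_abs, abs_of_nonneg hθ.1] at h2
    rw [inner_sub_left] at h1
    nlinarith [norm_nonneg (b - a), mul_le_mul_of_nonneg_right h2 (norm_nonneg (b - a))]
  have := hanti (Set.left_mem_Icc.2 zero_le_one) (Set.right_mem_Icc.2 zero_le_one) zero_le_one
  simp at this
  linarith

/-- Pathwise decrease of a stochastic prox-gradient step satisfying the sampled Armijo condition,
compared with the deterministic step `y` of step size `τ`. -/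
theorem armijo_step_decrease (hr : ConvexOn ℝ S r) {Lr : ℝ} (hLr : 0 ≤ Lr)
    (hrlip : ∀ z ∈ S, ∀ w ∈ S, |r z - r w| ≤ Lr * ‖z - w‖)
    {f : E → ℝ} {g : E → E} (hf : ∀ z ∈ S, HasGradientAt f (g z) z)
    {L : ℝ} (hL : 0 < L) (hg : ∀ z ∈ S, ∀ w ∈ S, ‖g z - g w‖ ≤ L * ‖z - w‖)
    {Bg : ℝ} (hBg : ∀ z ∈ S, ‖g z‖ ≤ Bg)
    {F : E → ℝ} {GF : E → E} (hF : ∀ z ∈ S, HasGradientAt F (GF z) z)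
    (hGF : ∀ z ∈ S, ∀ w ∈ S, ‖GF z - GF w‖ ≤ L * ‖z - w‖)
    {α c s t τ : ℝ} (hα : 0 ≤ α) (hc : 0 < c) (ht : t ∈ Set.Icc c s) (hτ : τ ∈ Set.Icc c s)
    {x p y q u : E} (hx : x ∈ S) (hp : IsProxPoint S r t (x - t • GF x) p)
    (hy : IsProxPoint S r τ (x - τ • g x) y) (hq : IsProxPoint S r s (x - s • g x) q)
    (harm : F p + r p ≤ F x + r x - (α / t) * ‖x - p‖ ^ 2) {ι : ℝ} (hι : 0 ≤ ι)
    (hι1 : t ≠ τ → ι = 1) (hG : IsProxPoint S r t (x - t • g x) u) :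
    f p + r p + α * c / 2 * ‖(1 / s) • (x - q)‖ ^ 2 ≤
      f x + r x + (F x - f x) + (f y - F y) + 1 / (2 * L) * ‖GF y - g y‖ ^ 2
        + (3 * L * s ^ 2 + α * c) * ‖GF x - g x‖ ^ 2
        + 3 * L * ((s - c) * (Lr + 3 * Bg)) ^ 2 * ι := by
  have ht0 : 0 < t := hc.trans_le ht.1
  have hτ0 : 0 < τ := hc.trans_le hτ.1
  have hs0 : 0 < s := ht0.trans_le ht.2
  have hBg0 : 0 ≤ Bg := (norm_nonneg _).trans (hBg x hx)
  have hdesc := descent_of_lipschitz_gradient hr.1 (h := fun z => f z - F z)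
    (w := fun z => g z - GF z) (fun z hz => (hf z hz).sub' (hF z hz)) (M := 2 * L)
    (fun z hz w hw => by
      calc ‖g z - GF z - (g w - GF w)‖ = ‖(g z - g w) - (GF z - GF w)‖ := by congr 1; abel
        _ ≤ ‖g z - g w‖ + ‖GF z - GF w‖ := norm_sub_le _ _
        _ ≤ 2 * L * ‖z - w‖ := by linarith [hg z hz w hw, hGF z hz w hw]) hy.1 hp.1
  have hyoung : ⟪g y - GF y, p - y⟫
      ≤ 1 / (2 * L) * ‖GF y - g y‖ ^ 2 + L / 2 * ‖p - y‖ ^ 2 := by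
    refine (real_inner_le_norm _ _).trans ?_
    rw [norm_sub_rev]
    have h : 1 / (2 * L) * ‖GF y - g y‖ ^ 2 + L / 2 * ‖p - y‖ ^ 2 - ‖GF y - g y‖ * ‖p - y‖
        = 1 / (2 * L) * (‖GF y - g y‖ - L * ‖p - y‖) ^ 2 := by
      field_simp
      ring
    have : 0 ≤ 1 / (2 * L) * (‖GF y - g y‖ - L * ‖p - y‖) ^ 2 := by positivity
    linarith
  have hpu : ‖p - u‖ ≤ t * ‖GF x - g x‖ := by
    refine (hp.norm_sub_le hr ht0 hG).trans_eq ?_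
    have : x - t • GF x - (x - t • g x) = -(t • (GF x - g x)) := by module
    rw [this, norm_neg, norm_smul, Real.norm_eq_abs, abs_of_pos ht0]
  have huy : ‖u - y‖ ^ 2 ≤ ((s - c) * (Lr + 3 * Bg)) ^ 2 * ι := by
    have h := hG.norm_sub_le_of_step hr hLr hrlip ht0 hτ0 hx hy
    by_cases htt : t = τ
    · have h0 : ‖u - y‖ = 0 := le_antisymm (by simpa [htt] using h) (norm_nonneg _)
      rw [h0, zero_pow two_ne_zero]
      positivity
    · rw [hι1 htt, mul_one]
      gcongr
      refine h.trans ?_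
      have h1 : |t - τ| ≤ s - c := abs_sub_le_iff.2
        ⟨by linarith [ht.2, hτ.1], by linarith [ht.1, hτ.2]⟩
      have h2 := hBg x hx
      have h3 : 0 ≤ s - c := by linarith [ht.1, ht.2]
      gcongr
      linarith
  have hpy : ‖p - y‖ ^ 2 ≤ 2 * (s ^ 2 * ‖GF x - g x‖ ^ 2)
      + 2 * (((s - c) * (Lr + 3 * Bg)) ^ 2 * ι) := by
    have h1 : ‖p - u‖ ≤ s * ‖GF x - g x‖ :=
      hpu.trans (mul_le_mul_of_nonneg_right ht.2 (norm_nonneg _))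
    have h2 : ‖p - u‖ ^ 2 ≤ s ^ 2 * ‖GF x - g x‖ ^ 2 := by
      rw [← mul_pow]
      gcongr
    have h3 : ‖p - y‖ ≤ ‖p - u‖ + ‖u - y‖ := norm_sub_le_norm_sub_add_norm_sub _ _ _
    have h4 : ‖p - y‖ ^ 2 ≤ (‖p - u‖ + ‖u - y‖) ^ 2 := by gcongr
    nlinarith [sq_nonneg (‖p - u‖ - ‖u - y‖)]
  have hgrad : α * c / 2 * ‖(1 / s) • (x - q)‖ ^ 2
      ≤ α / t * ‖x - p‖ ^ 2 + α * c * ‖GF x - g x‖ ^ 2 := by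
    have h1 := hG.norm_gradientMap_antitone hr ht0 ht.2 hq
    rw [← one_div, norm_smul t⁻¹, Real.norm_eq_abs, abs_of_pos (inv_pos.2 ht0)] at h1
    have h2 : ‖x - u‖ ≤ ‖x - p‖ + t * ‖GF x - g x‖ :=
      (norm_sub_le_norm_sub_add_norm_sub _ _ _).trans (by gcongr)
    have h3 : ‖(1 / s) • (x - q)‖ ≤ t⁻¹ * ‖x - p‖ + ‖GF x - g x‖ := by
      calc _ ≤ t⁻¹ * (‖x - p‖ + t * ‖GF x - g x‖) := h1.trans (by gcongr)
        _ = _ := by field_simp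
    have h4 : ‖(1 / s) • (x - q)‖ ^ 2 ≤ (t⁻¹ * ‖x - p‖ + ‖GF x - g x‖) ^ 2 := by gcongr
    have h5 : ‖(1 / s) • (x - q)‖ ^ 2 ≤ 2 * (t⁻¹ * ‖x - p‖) ^ 2 + 2 * ‖GF x - g x‖ ^ 2 := by
      nlinarith [sq_nonneg (t⁻¹ * ‖x - p‖ - ‖GF x - g x‖)]
    have h6 : α * c * (t⁻¹ * ‖x - p‖) ^ 2 ≤ α / t * ‖x - p‖ ^ 2 := by
      calc _ ≤ α * t * (t⁻¹ * ‖x - p‖) ^ 2 := by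
            gcongr
            exact ht.1
        _ = _ := by field_simp
    have h7 := mul_le_mul_of_nonneg_left h5 (by positivity : 0 ≤ α * c / 2)
    linarith
  have h8 := mul_le_mul_of_nonneg_left hpy (by positivity : 0 ≤ 3 / 2 * L)
  linarith

end Prox

section Measure

theorem ContinuousOn.comp_stronglyMeasurable_of_mem {Ω X Y : Type*} {m : MeasurableSpace Ω}
    [TopologicalSpace X] [SecondCountableTopology X] [TopologicalSpace.PseudoMetrizableSpace X]
    [MeasurableSpace X] [BorelSpace X] [TopologicalSpace Y]
    {h : X → Y} {T : Set X} (hh : ContinuousOn h T) {u : Ω → X} (hu : Measurable u)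
    (huT : ∀ ω, u ω ∈ T) : StronglyMeasurable fun ω => h (u ω) :=
  (continuousOn_iff_continuous_domRestrict.1 hh).comp_stronglyMeasurable
    (hu.subtype_mk (h := huT)).stronglyMeasurable

theorem integrable_and_integral_eq_of_condExp_ae_eq {Ω E : Type*} {m m0 : MeasurableSpace Ω}
    {μ : Measure Ω} [IsFiniteMeasure μ] [NormedAddCommGroup E] [NormedSpace ℝ E]
    [CompleteSpace E] (hm : m ≤ m0) {X Y : Ω → E} (h : μ[X|m] =ᵐ[μ] Y) :
    Integrable Y μ ∧ ∫ ω, X ω ∂μ = ∫ ω, Y ω ∂μ :=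
  ⟨integrable_condExp.congr h, by rw [← integral_condExp hm, integral_congr_ae h]⟩

theorem integral_le_of_condExp_le {Ω : Type*} {m m0 : MeasurableSpace Ω}
    {μ : Measure Ω} [IsProbabilityMeasure μ] (hm : m ≤ m0) {X : Ω → ℝ} {C : ℝ}
    (h : ∀ᵐ ω ∂μ, (μ[X|m]) ω ≤ C) : ∫ ω, X ω ∂μ ≤ C := by
  rw [← integral_condExp hm]
  refine (integral_mono_ae integrable_condExp (integrable_const C) h).trans ?_
  simp

end Measure

theorem stmt14 {n : ℕ} {Ω : Type*} {m0 : MeasurableSpace Ω} {μ : Measure Ω}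
    [IsProbabilityMeasure μ] (ℱ : Filtration ℕ m0)
    (S : Set (EuclideanSpace ℝ (Fin n))) (hSne : S.Nonempty) (hSclosed : IsClosed S)
    (r : EuclideanSpace ℝ (Fin n) → ℝ) (hrconv : ConvexOn ℝ S r)
    (Lr : ℝ) (hLr : 0 ≤ Lr)
    (hrlip : ∀ z ∈ S, ∀ w ∈ S, |r z - r w| ≤ Lr * ‖z - w‖)
    (prox : ℝ → EuclideanSpace ℝ (Fin n) → EuclideanSpace ℝ (Fin n))
    (hprox_mem : ∀ t : ℝ, 0 < t → ∀ z, prox t z ∈ S)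
    (hprox_min : ∀ t : ℝ, 0 < t → ∀ z, ∀ y ∈ S,
      r (prox t z) + ‖prox t z - z‖ ^ 2 / (2 * t) ≤ r y + ‖y - z‖ ^ 2 / (2 * t))
    (hprox_uniq : ∀ t : ℝ, 0 < t → ∀ z, ∀ y ∈ S,
      (∀ y' ∈ S, r y + ‖y - z‖ ^ 2 / (2 * t) ≤ r y' + ‖y' - z‖ ^ 2 / (2 * t)) → y = prox t z)
    (f : EuclideanSpace ℝ (Fin n) → ℝ) (g : EuclideanSpace ℝ (Fin n) → EuclideanSpace ℝ (Fin n))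
    (U : Set (EuclideanSpace ℝ (Fin n))) (hU : IsOpen U) (hSU : S ⊆ U)
    (hf : ∀ z ∈ U, HasGradientAt f (g z) z)
    (L : ℝ) (hL : 0 < L)
    (hglip : ∀ z ∈ S, ∀ w ∈ S, ‖g z - g w‖ ≤ L * ‖z - w‖)
    (Bg : ℝ) (hBg : ∀ z ∈ S, ‖g z‖ ≤ Bg)
    (φinf : ℝ) (hφinf : ∀ z ∈ S, φinf ≤ f z + r z)
    (α β s : ℝ) (hα : α ∈ Set.Ioo (0:ℝ) 1) (hβ : β ∈ Set.Ioo (0:ℝ) 1) (hs : 0 < s)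
    (c : ℝ) (hc : c = min s (2 * (1 - α) * β / L))
    (σ : ℝ) (hσ : 0 < σ)
    (N : ℕ → ℕ) (hN : ∀ k, 0 < N k)
    (x : ℕ → Ω → EuclideanSpace ℝ (Fin n)) (t : ℕ → Ω → ℝ)
    (x₀ : EuclideanSpace ℝ (Fin n)) (hx₀ : x₀ ∈ S) (hx₀det : ∀ ω, x 0 ω = x₀)
    (hxmeas : ∀ k, StronglyMeasurable[ℱ k] (x k))
    (htmeas : ∀ k, StronglyMeasurable[ℱ (k + 1)] (t k))
    (htbd : ∀ k, ∀ᵐ ω ∂μ, c ≤ t k ω ∧ t k ω ≤ s)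
    (F : ℕ → Ω → EuclideanSpace ℝ (Fin n) → ℝ) (GF : ℕ → Ω → EuclideanSpace ℝ (Fin n) → EuclideanSpace ℝ (Fin n))
    (hFgrad : ∀ k, ∀ᵐ ω ∂μ, (∀ z ∈ U, HasGradientAt (F k ω) (GF k ω z) z) ∧
      ∀ z ∈ S, ∀ w ∈ S, ‖GF k ω z - GF k ω w‖ ≤ L * ‖z - w‖)
    (horacle_f : ∀ k, ∀ y : Ω → EuclideanSpace ℝ (Fin n),
      StronglyMeasurable[ℱ k] y → (∀ ω, y ω ∈ S) →
      Integrable (fun ω => F k ω (y ω)) μ ∧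
        μ[(fun ω => F k ω (y ω))|ℱ k] =ᵐ[μ] fun ω => f (y ω))
    (horacle_g : ∀ k, ∀ y : Ω → EuclideanSpace ℝ (Fin n),
      StronglyMeasurable[ℱ k] y → (∀ ω, y ω ∈ S) →
      Integrable (fun ω => GF k ω (y ω)) μ ∧
        μ[(fun ω => GF k ω (y ω))|ℱ k] =ᵐ[μ] fun ω => g (y ω))
    (horacle_var : ∀ k, ∀ y : Ω → EuclideanSpace ℝ (Fin n),
      StronglyMeasurable[ℱ k] y → (∀ ω, y ω ∈ S) →
      Integrable (fun ω => ‖GF k ω (y ω) - g (y ω)‖ ^ 2) μ ∧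
        ∀ᵐ ω ∂μ, (μ[(fun ω' => ‖GF k ω' (y ω') - g (y ω')‖ ^ 2)|ℱ k]) ω ≤ σ ^ 2 / N k)
    (hupdate : ∀ k, ∀ᵐ ω ∂μ,
      x (k + 1) ω = prox (t k ω) (x k ω - t k ω • GF k ω (x k ω)))
    (K : ℕ) (hK : 1 ≤ K)
    (l₀ : ℕ) (hl₀ : 0 < l₀)
    (hNdef : ∀ k, k < K → N k = k + 1)
    (harmijo : ∀ k, k < K → ∀ᵐ ω ∂μ, F k ω (x (k + 1) ω) + r (x (k + 1) ω)
        ≤ F k ω (x k ω) + r (x k ω) - (α / t k ω) * ‖x k ω - x (k + 1) ω‖ ^ 2)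
    (hφint : ∀ k, k ≤ K → Integrable (fun ω => f (x k ω) + r (x k ω)) μ)
    (hGint : ∀ k, k < K → Integrable (fun ω => ‖(1 / s) • (x k ω - prox s (x k ω - s • g (x k ω)))‖ ^ 2) μ)
    (hFint : ∀ k, k < K → Integrable (fun ω => F k ω (x (k + 1) ω) + r (x (k + 1) ω)) μ)
    (hchange : ∀ᵐ ω ∂μ,
      (((Finset.range K).filter (fun i => t i ω ≠ if i = 0 then s else t (i - 1) ω)).card : ℝ)
        ≤ ((⌈Real.logb 2 (((l₀ : ℝ) + K) / l₀)⌉ : ℤ) : ℝ) * ((⌈max (Real.logb (1 / β) (s * L / (2 * (1 - α)))) 0 + 2⌉ : ℤ) : ℝ)) :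
    (1 / K) * ∑ k ∈ Finset.range K, ∫ ω, ‖(1 / s) • (x k ω - prox s (x k ω - s • g (x k ω)))‖ ^ 2 ∂μ
      ≤ 2 * (f x₀ + r x₀ - φinf) / (α * c * K)
        + (1 / L + 6 * L * s ^ 2 + 2 * α * c) * σ ^ 2 * (Real.log K + 1) / (α * c * K)
        + 6 * L * (s - c) ^ 2 * (Lr + 3 * Bg) ^ 2 * ((⌈max (Real.logb (1 / β) (s * L / (2 * (1 - α)))) 0 + 2⌉ : ℤ) : ℝ)
          * ((⌈Real.logb 2 (((l₀ : ℝ) + K) / l₀)⌉ : ℤ) : ℝ) / (α * c * K) := by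
  set A := ((⌈Real.logb 2 (((l₀ : ℝ) + K) / l₀)⌉ : ℤ) : ℝ)
  set B := ((⌈max (Real.logb (1 / β) (s * L / (2 * (1 - α)))) 0 + 2⌉ : ℤ) : ℝ)
  have hprox : ∀ t : ℝ, 0 < t → ∀ z, IsProxPoint S r t z (prox t z) :=
    fun t ht z => ⟨hprox_mem t ht z, hprox_min t ht z⟩
  have hα0 := hα.1
  have hc0 : 0 < c := by
    rw [hc]
    have := hβ.1
    have : 0 < 1 - α := sub_pos.2 hα.2
    positivity
  have hcs : c ≤ s := hc ▸ min_le_left _ _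
  have hfS : ∀ z ∈ S, HasGradientAt f (g z) z := fun z hz => hf z (hSU hz)
  have hxS : ∀ k, ∀ᵐ ω ∂μ, x k ω ∈ S := by
    rintro (_ | k)
    · exact .of_forall fun ω => by rwa [hx₀det]
    · filter_upwards [hupdate k, htbd k] with ω h1 h2
      rw [h1]
      exact hprox_mem _ (hc0.trans_le h2.1) _
  set τ : ℕ → Ω → ℝ := fun k ω => if k = 0 then s else t (k - 1) ω with hτdef
  have hτmeas : ∀ k, StronglyMeasurable[ℱ k] (τ k) := by
    rintro (_ | k)
    · exact stronglyMeasurable_const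
    · exact htmeas k
  have hτbd : ∀ k, ∀ᵐ ω ∂μ, τ k ω ∈ Set.Icc c s := by
    rintro (_ | k)
    · exact .of_forall fun ω => Set.right_mem_Icc.2 hcs
    · exact htbd k
  set ι : ℕ → Ω → ℝ := fun k => {ω | t k ω ≠ τ k ω}.indicator 1 with hιdef
  have hιint : ∀ k, Integrable (ι k) μ := fun k =>
    (integrable_const (1 : ℝ)).indicator (((measurableSet_eq_fun
      ((htmeas k).mono (ℱ.le _)).measurable ((hτmeas k).mono (ℱ.le _)).measurable)).compl)
  set Gn : ℕ → Ω → ℝ := fun k ω => ‖(1 / s) • (x k ω - prox s (x k ω - s • g (x k ω)))‖ ^ 2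
    with hGndef
  set φ : ℕ → Ω → ℝ := fun k ω => f (x k ω) + r (x k ω) with hφdef
  set D : ℝ := ((s - c) * (Lr + 3 * Bg)) ^ 2 with hD
  have hstep : ∀ k, k < K → ∫ ω, φ (k + 1) ω ∂μ + α * c / 2 * ∫ ω, Gn k ω ∂μ ≤
      ∫ ω, φ k ω ∂μ + (1 / (2 * L) + (3 * L * s ^ 2 + α * c)) * (σ ^ 2 / (k + 1 : ℝ))
        + 3 * L * D * ∫ ω, ι k ω ∂μ := by
    intro k hk
    classical
    -- everywhere-admissible versions of the iterate and of the previous step size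
    obtain ⟨x', hx'meas, hx'S, hx'eq⟩ : ∃ x' : Ω → EuclideanSpace ℝ (Fin n),
        StronglyMeasurable[ℱ k] x' ∧ (∀ ω, x' ω ∈ S) ∧ ∀ᵐ ω ∂μ, x' ω = x k ω := by
      refine ⟨fun ω => if x k ω ∈ S then x k ω else x₀, ?_, fun ω => ?_, ?_⟩
      · exact StronglyMeasurable.ite ((hxmeas k).measurable hSclosed.measurableSet)
          (hxmeas k) stronglyMeasurable_const
      · dsimp only
        split_ifs with h
        exacts [h, hx₀]
      · filter_upwards [hxS k] with ω h
        exact if_pos h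
    obtain ⟨τ', hτ'meas, hτ'bd, hτ'eq⟩ : ∃ τ' : Ω → ℝ,
        StronglyMeasurable[ℱ k] τ' ∧ (∀ ω, τ' ω ∈ Set.Icc c s) ∧ ∀ᵐ ω ∂μ, τ' ω = τ k ω := by
      refine ⟨fun ω => max c (min s (τ k ω)),
        (continuous_const.max (continuous_const.min continuous_id)).comp_stronglyMeasurable
          (hτmeas k),
        fun ω => ⟨le_max_left _ _, max_le hcs (min_le_left _ _)⟩, ?_⟩
      filter_upwards [hτbd k] with ω h
      rw [min_eq_right h.2, max_eq_right h.1]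
    set y : Ω → EuclideanSpace ℝ (Fin n) := fun ω => prox (τ' ω) (x' ω - τ' ω • g (x' ω)) with hy
    have hymeas : StronglyMeasurable[ℱ k] y :=
      (continuousOn_proxGradient hrconv hLr hrlip hL.le hglip hBg hprox
        (s := s) hc0).comp_stronglyMeasurable_of_mem
        (u := fun ω => (τ' ω, x' ω)) (hτ'meas.measurable.prodMk hx'meas.measurable)
        fun ω => ⟨hτ'bd ω, hx'S ω⟩
    have hyS : ∀ ω, y ω ∈ S := fun ω => hprox_mem _ (hc0.trans_le (hτ'bd ω).1) _
    have hFx := horacle_f k x' hx'meas hx'S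
    have hFy := horacle_f k y hymeas hyS
    have hfx := integrable_and_integral_eq_of_condExp_ae_eq (ℱ.le k) hFx.2
    have hfy := integrable_and_integral_eq_of_condExp_ae_eq (ℱ.le k) hFy.2
    have hVx := horacle_var k x' hx'meas hx'S
    have hVy := horacle_var k y hymeas hyS
    have hvx := integral_le_of_condExp_le (ℱ.le k) hVx.2
    have hvy := integral_le_of_condExp_le (ℱ.le k) hVy.2
    rw [hNdef k hk] at hvx hvy
    push_cast at hvx hvy
    have hpath : ∀ᵐ ω ∂μ, φ (k + 1) ω + α * c / 2 * Gn k ω ≤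
        φ k ω + (F k ω (x' ω) - f (x' ω)) + (f (y ω) - F k ω (y ω))
          + 1 / (2 * L) * ‖GF k ω (y ω) - g (y ω)‖ ^ 2
          + (3 * L * s ^ 2 + α * c) * ‖GF k ω (x' ω) - g (x' ω)‖ ^ 2 + 3 * L * D * ι k ω := by
      filter_upwards [hx'eq, hτ'eq, hFgrad k, hupdate k, harmijo k hk, htbd k]
        with ω h1 h2 h3 h4 h5 h6
      have ht0 : 0 < t k ω := hc0.trans_le h6.1
      have hxω : x k ω ∈ S := h1 ▸ hx'S ω
      have hτω : τ k ω ∈ Set.Icc c s := h2 ▸ hτ'bd ω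
      have hyω : y ω = prox (τ k ω) (x k ω - τ k ω • g (x k ω)) := by
        simp only [hy, h1, h2]
      rw [h1]
      refine armijo_step_decrease hrconv hLr hrlip hfS hL hglip hBg
        (fun z hz => h3.1 z (hSU hz)) h3.2 hα0.le hc0 h6 hτω hxω
        (h4 ▸ hprox _ ht0 _) (hyω ▸ hprox _ (hc0.trans_le hτω.1) _) (hprox s hs _) h5
        (Set.indicator_nonneg (fun _ _ => zero_le_one) ω)
        (fun h => Set.indicator_of_mem (s := {ω | t k ω ≠ τ k ω}) h 1) (hprox _ ht0 _)
    have hi1 : Integrable (φ (k + 1)) μ := hφint (k + 1) hk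
    have hi2 : Integrable (φ k) μ := hφint k hk.le
    have hi3 : Integrable (Gn k) μ := hGint k hk
    have hi4 := hFx.1.sub hfx.1
    have hi5 := hfy.1.sub hFy.1
    have hi6 := hVy.1.const_mul (1 / (2 * L))
    have hi7 := hVx.1.const_mul (3 * L * s ^ 2 + α * c)
    have hi8 := (hιint k).const_mul (3 * L * D)
    have hmono := integral_mono_ae (hi1.add (hi3.const_mul (α * c / 2)))
      (((((hi2.add hi4).add hi5).add hi6).add hi7).add hi8) hpath
    rw [integral_add' hi1 (hi3.const_mul _),
      integral_add' ((((hi2.add hi4).add hi5).add hi6).add hi7) hi8,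
      integral_add' (((hi2.add hi4).add hi5).add hi6) hi7,
      integral_add' ((hi2.add hi4).add hi5) hi6, integral_add' (hi2.add hi4) hi5,
      integral_add' hi2 hi4, integral_sub' hFx.1 hfx.1, integral_sub' hfy.1 hFy.1,
      integral_const_mul, integral_const_mul, integral_const_mul, integral_const_mul] at hmono
    have h1 := mul_le_mul_of_nonneg_left hvy (by positivity : 0 ≤ 1 / (2 * L))
    have h2 := mul_le_mul_of_nonneg_left hvx (by positivity : 0 ≤ 3 * L * s ^ 2 + α * c)
    linarith [hfx.2, hfy.2]
  have htel : ∀ k, k ≤ K →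
      ∫ ω, φ k ω ∂μ + α * c / 2 * ∑ i ∈ Finset.range k, ∫ ω, Gn i ω ∂μ ≤
      f x₀ + r x₀ + (1 / (2 * L) + (3 * L * s ^ 2 + α * c)) * σ ^ 2
          * ∑ i ∈ Finset.range k, (i + 1 : ℝ)⁻¹
        + 3 * L * D * ∑ i ∈ Finset.range k, ∫ ω, ι i ω ∂μ := by
    intro k
    induction k with
    | zero => simp [hφdef, hx₀det]
    | succ k ih =>
      intro hk
      rw [Finset.sum_range_succ, Finset.sum_range_succ, Finset.sum_range_succ]
      have h1 := ih (Nat.le_of_succ_le hk)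
      have h2 := hstep k hk
      rw [div_eq_mul_inv (σ ^ 2)] at h2
      linarith
  have hφK : φinf ≤ ∫ ω, φ K ω ∂μ := by
    have h := integral_mono_ae (integrable_const φinf) (hφint K le_rfl)
      ((hxS K).mono fun ω h => hφinf _ h)
    simpa using h
  have hharm : ∑ i ∈ Finset.range K, (i + 1 : ℝ)⁻¹ ≤ Real.log K + 1 := by
    have h := harmonic_le_one_add_log K
    rw [harmonic] at h
    push_cast at h
    linarith
  have hιsum : ∑ i ∈ Finset.range K, ∫ ω, ι i ω ∂μ ≤ A * B := by
    rw [← integral_finsetSum _ fun i _ => hιint i]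
    refine (integral_mono_ae (integrable_finsetSum _ fun i _ => hιint i)
      (integrable_const (A * B))
      (hchange.mono fun ω h => ?_)).trans_eq ?_
    swap
    · rw [integral_const, probReal_univ, one_smul]
    refine le_trans (le_of_eq ?_) h
    simp [hιdef, hτdef, Set.indicator_apply, Finset.sum_ite]
  have hmain := htel K le_rfl
  have hK0 : (0 : ℝ) < K := by exact_mod_cast hK
  have h1 := mul_le_mul_of_nonneg_left hharm
    (by positivity : 0 ≤ (1 / (2 * L) + (3 * L * s ^ 2 + α * c)) * σ ^ 2)
  have h2 := mul_le_mul_of_nonneg_left hιsum (by positivity : 0 ≤ 3 * L * D)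
  have h3 : α * c / 2 * ∑ i ∈ Finset.range K, ∫ ω, Gn i ω ∂μ ≤ (f x₀ + r x₀ - φinf)
      + (1 / (2 * L) + (3 * L * s ^ 2 + α * c)) * σ ^ 2 * (Real.log K + 1)
      + 3 * L * D * (A * B) := by linarith
  calc _ = 2 / (α * c * K) * (α * c / 2 * ∑ i ∈ Finset.range K, ∫ ω, Gn i ω ∂μ) := by
        field_simp
        rfl
    _ ≤ 2 / (α * c * K) * _ := mul_le_mul_of_nonneg_left h3 (by positivity)
    _ = _ := by
        rw [hD]
        field_simp
        ring
end

section
/- Let r : ℝ^n → ℝ ∪ {+∞} be proper, closed and convex, let h : ℝ^n → ℝ be any function, let α ∈ ℝ, x ∈ dom(r), g̃ ∈ ℝ^n, t > 0, and set x⁺ ≜ prox_{t r}(x − t g̃). If the convex linesearch condition h(x⁺) ≤ h(x) − g̃ᵀ(x − x⁺) + ((1−α)/t)‖x − x⁺‖² holds, then the Armijo condition h(x⁺) + r(x⁺) ≤ h(x) + r(x) − (α/t)‖x − x⁺‖² holds. -/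
open MeasureTheory Filter
open scoped RealInnerProductSpace

/-- The variational inequality satisfied by a minimizer `p` of `r + ‖· - z‖² / (2t)` over `S`. -/
theorem ConvexOn.sub_le_inner_div_of_prox {E : Type*} [NormedAddCommGroup E]
    [InnerProductSpace ℝ E] {S : Set E} {r : E → ℝ} (hr : ConvexOn ℝ S r) {t : ℝ} (ht : 0 < t)
    {p z x : E} (hp : p ∈ S) (hx : x ∈ S)
    (hmin : ∀ y ∈ S, r p + ‖p - z‖ ^ 2 / (2 * t) ≤ r y + ‖y - z‖ ^ 2 / (2 * t)) :
    r p - r x ≤ ⟪p - z, x - p⟫ / t := by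
  have key : ∀ s : ℝ, 0 < s → s ≤ 1 →
      r p - r x ≤ ⟪p - z, x - p⟫ / t + s * (‖x - p‖ ^ 2 / (2 * t)) := by
    intro s hs hs1
    have hmem := hr.1 hp hx (sub_nonneg.2 hs1) hs.le (sub_add_cancel 1 s)
    have hconv := hr.2 hp hx (sub_nonneg.2 hs1) hs.le (sub_add_cancel 1 s)
    have hle := hmin _ hmem
    have hseg : (1 - s) • p + s • x - z = (p - z) + s • (x - p) := by module
    rw [hseg, norm_add_sq_real, inner_smul_right, norm_smul, mul_pow, Real.norm_eq_abs,
      sq_abs] at hle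
    simp only [smul_eq_mul] at hconv
    have hexp : (‖p - z‖ ^ 2 + 2 * (s * ⟪p - z, x - p⟫) + s ^ 2 * ‖x - p‖ ^ 2) / (2 * t)
        = ‖p - z‖ ^ 2 / (2 * t)
          + s * (⟪p - z, x - p⟫ / t + s * (‖x - p‖ ^ 2 / (2 * t))) := by
      field_simp
      ring
    rw [hexp] at hle
    refine le_of_mul_le_mul_left ?_ hs
    linarith
  have hlim : Tendsto (fun s : ℝ => ⟪p - z, x - p⟫ / t + s * (‖x - p‖ ^ 2 / (2 * t)))
      (nhdsWithin 0 (Set.Ioi 0)) (nhds (⟪p - z, x - p⟫ / t)) := by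
    have hcont : Continuous fun s : ℝ =>
        ⟪p - z, x - p⟫ / t + s * (‖x - p‖ ^ 2 / (2 * t)) := by fun_prop
    simpa using (hcont.tendsto 0).mono_left nhdsWithin_le_nhds
  refine ge_of_tendsto hlim ?_
  filter_upwards [Ioc_mem_nhdsGT (zero_lt_one' ℝ)] with s hs
  exact key s hs.1 hs.2

theorem stmt17 {n : ℕ}
    (S : Set (EuclideanSpace ℝ (Fin n))) (hSne : S.Nonempty) (hSclosed : IsClosed S)
    (r : EuclideanSpace ℝ (Fin n) → ℝ) (hrconv : ConvexOn ℝ S r)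
    (prox : ℝ → EuclideanSpace ℝ (Fin n) → EuclideanSpace ℝ (Fin n))
    (hprox_mem : ∀ t : ℝ, 0 < t → ∀ z, prox t z ∈ S)
    (hprox_min : ∀ t : ℝ, 0 < t → ∀ z, ∀ y ∈ S,
      r (prox t z) + ‖prox t z - z‖ ^ 2 / (2 * t) ≤ r y + ‖y - z‖ ^ 2 / (2 * t))
    (hprox_uniq : ∀ t : ℝ, 0 < t → ∀ z, ∀ y ∈ S,
      (∀ y' ∈ S, r y + ‖y - z‖ ^ 2 / (2 * t) ≤ r y' + ‖y' - z‖ ^ 2 / (2 * t)) → y = prox t z)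
    (h : EuclideanSpace ℝ (Fin n) → ℝ) (α : ℝ) (x : EuclideanSpace ℝ (Fin n)) (hx : x ∈ S) (gtilde : EuclideanSpace ℝ (Fin n)) (t : ℝ) (ht : 0 < t)
    (hls : h (prox t (x - t • gtilde))
        ≤ h x - ⟪gtilde, x - prox t (x - t • gtilde)⟫
          + ((1 - α) / t) * ‖x - prox t (x - t • gtilde)‖ ^ 2) :
    h (prox t (x - t • gtilde)) + r (prox t (x - t • gtilde))
      ≤ h x + r x - (α / t) * ‖x - prox t (x - t • gtilde)‖ ^ 2 := by
  set p := prox t (x - t • gtilde) with hp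
  have hvar := hrconv.sub_le_inner_div_of_prox ht (hprox_mem t ht (x - t • gtilde)) hx
    (hprox_min t ht (x - t • gtilde))
  rw [← hp] at hvar
  have hinner : ⟪p - (x - t • gtilde), x - p⟫ / t = ⟪gtilde, x - p⟫ - ‖x - p‖ ^ 2 / t := by
    have hsplit : p - (x - t • gtilde) = t • gtilde - (x - p) := by module
    rw [hsplit, inner_sub_left, real_inner_smul_left, real_inner_self_eq_norm_sq]
    field_simp
  have hcoef : (1 - α) / t * ‖x - p‖ ^ 2 = ‖x - p‖ ^ 2 / t - α / t * ‖x - p‖ ^ 2 := by ring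
  linarith
end
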